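/- arXiv:2204.02463 — 2 statements merged into one kernel-verified Lean document; each statement's English description precedes it below -/
import Mathlib

section
/- Let P be a finitely generated group with a non-nesting action by pretree automorphisms on an interval complete median pretree K. If P fixes a point of K and K' is any nonempty P-invariant full subpretree of K, then P fixes a point of K'. -/
open Set

universe u v w

namespace RelHypBoundary

/-! ### Pretrees -/

variable {K : Type*} {G : Type*}

/-- `btw x y z` means `y` is between `x` and `z`.  The open interval `(x,z)`. -/
def openInt (btw : K → K → K → Prop) (x z : K) : Set K := {y | btw x y z}

/-- The closed interval `[x,z]`. -/
def closedInt (btw : K → K → K → Prop) (x z : K) : Set K :=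
  openInt btw x z ∪ {x, z}

/-- A subset of a pretree is full if it contains the closed interval between
any two of its points. -/
def IsFull (btw : K → K → K → Prop) (A : Set K) : Prop :=
  ∀ x ∈ A, ∀ z ∈ A, closedInt btw x z ⊆ A

/-- The pretree axioms for a ternary betweenness relation `btw x y z`
("`y` is between `x` and `z`"). -/
structure IsPretree (btw : K → K → K → Prop) : Prop where
  ne_of_btw : ∀ {x y z : K}, btw x y z → x ≠ z
  symm : ∀ {x y z : K}, btw x y z → btw z y x
  asymm : ∀ {x y z : K}, btw x y z → ¬ btw x z y
  split : ∀ {x y z : K} (w : K), btw x y z → y ≠ w → btw x y w ∨ btw w y z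

/-- A median pretree: every triple of points has a median. -/
def IsMedianPretree (btw : K → K → K → Prop) : Prop :=
  ∀ x y z : K, ∃ m : K,
    m ∈ closedInt btw x y ∧ m ∈ closedInt btw y z ∧ m ∈ closedInt btw z x

/-- An arc: a nonempty full subset that is linearly ordered by betweenness. -/
def IsArc (btw : K → K → K → Prop) (A : Set K) : Prop :=
  A.Nonempty ∧ IsFull btw A ∧
    ∀ x ∈ A, ∀ y ∈ A, ∀ z ∈ A, x ≠ y → y ≠ z → x ≠ z →
      btw x y z ∨ btw y z x ∨ btw z x y

/-- `A` is an interval (open, half-open or closed). -/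
def IsIntervalSet (btw : K → K → K → Prop) (A : Set K) : Prop :=
  ∃ x z : K, A = openInt btw x z ∨ A = closedInt btw x z ∨
    A = insert x (openInt btw x z) ∨ A = insert z (openInt btw x z)

/-- A pretree is complete if every arc is an interval. -/
def IsCompletePretree (btw : K → K → K → Prop) : Prop :=
  ∀ A : Set K, IsArc btw A → IsIntervalSet btw A

/-- A pretree is interval complete if every arc contained in an interval is an interval. -/
def IsIntervalComplete (btw : K → K → K → Prop) : Prop :=
  ∀ A : Set K, IsArc btw A → (∃ x z : K, A ⊆ closedInt btw x z) → IsIntervalSet btw A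

/-- The interior of a pretree: the set of non-terminal points. -/
def pretreeInterior (btw : K → K → K → Prop) : Set K :=
  {y | ∃ x z : K, btw x y z}

/-- Two points are adjacent if they are distinct and the open interval between
them is empty. -/
def AdjacentP (btw : K → K → K → Prop) (x z : K) : Prop :=
  x ≠ z ∧ ∀ y : K, ¬ btw x y z

/-- A map preserves betweenness. -/
def PreservesBtw (btw : K → K → K → Prop) (f : K → K) : Prop :=
  ∀ x y z : K, btw x y z ↔ btw (f x) (f y) (f z)

/-- A pretree automorphism: a betweenness-preserving bijection. -/
def IsPretreeAuto (btw : K → K → K → Prop) (e : K ≃ K) : Prop :=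
  ∀ x y z : K, btw x y z ↔ btw (e x) (e y) (e z)

/-- A group action (given by `act`) on a pretree is non-nesting if no group
element maps a closed interval properly into itself. -/
def NonNesting (btw : K → K → K → Prop) (act : G → K → K) : Prop :=
  ∀ (g : G) (x z : K), ¬ (act g '' closedInt btw x z ⊂ closedInt btw x z)

/-- Non-nesting for the restricted action on a subpretree `S` (intervals of the
subpretree are intervals of the ambient pretree intersected with `S`). -/
def NonNestingOn (btw : K → K → K → Prop) (S : Set K) (act : G → K → K) : Prop :=
  ∀ (g : G) (x z : K), x ∈ S → z ∈ S →
    ¬ (act g '' (closedInt btw x z ∩ S) ⊂ closedInt btw x z ∩ S)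

/-- `p` is a connector point of the ordered pair `(Y, X)`. -/
def IsConnector (btw : K → K → K → Prop) (Y X : Set K) (p : K) : Prop :=
  p ∈ Y ∧ ∀ x ∈ X, closedInt btw x p ∩ Y = {p}

/-- A full relation: an equivalence relation all of whose classes are full. -/
def IsFullRelation (btw : K → K → K → Prop) (s : Setoid K) : Prop :=
  ∀ x y : K, s.r x y → ∀ z ∈ closedInt btw x y, s.r x z

/-- The induced betweenness on the quotient by a full relation: `Y` lies between
`X` and `Z` iff some `y₀ ∈ Y` lies between every `x ∈ X` and every `z ∈ Z`. -/
def quotBtw (btw : K → K → K → Prop) (s : Setoid K) :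
    Quotient s → Quotient s → Quotient s → Prop := fun X Y Z =>
  ∃ y₀ : K, Quotient.mk s y₀ = Y ∧
    ∀ x z : K, Quotient.mk s x = X → Quotient.mk s z = Z → btw x y₀ z

/-- Quotient betweenness expressed on representatives, for an arbitrary
relation `r`: the class of `y` lies between the class of `x` and the class of
`z`. -/
def qBtw (btw : K → K → K → Prop) (r : K → K → Prop) (x y z : K) : Prop :=
  ∃ y₀ : K, r y y₀ ∧ ∀ x' z' : K, r x x' → r z z' → btw x' y₀ z'

/-- The induced betweenness on the quotient `Quot r`. -/
def quotBtwQ (btw : K → K → K → Prop) (r : K → K → Prop) :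
    Quot r → Quot r → Quot r → Prop := fun X Y Z =>
  ∃ x y z : K, Quot.mk r x = X ∧ Quot.mk r y = Y ∧ Quot.mk r z = Z ∧ qBtw btw r x y z

/-- The transfinite sequence of relations `∼_α` on a pretree `K`:
`∼₀` is equality; `∼_{α+1}` identifies `x, y` whenever the closed interval
between their classes in `K_α = K/∼_α` contains only finitely many classes;
at limits one takes the union. -/
noncomputable def relSeq (btw : K → K → K → Prop) (α : Ordinal.{v}) : K → K → Prop :=
  Ordinal.limitRecOn α (· = ·)
    (fun _ r => fun x y => ∃ S : Set K, S.Finite ∧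
      ∀ w : K, (qBtw btw r x w y ∨ r w x ∨ r w y) → ∃ s ∈ S, r w s)
    (fun α _ ih => fun x y => ∃ β : Ordinal, ∃ h : β < α, ih β h x y)

/-! ### Continua and cut points -/

variable {M : Type u} [TopologicalSpace M]

/-- A cut point of a connected space: a point whose complement is disconnected. -/
def IsCutPoint (M : Type u) [TopologicalSpace M] (c : M) : Prop :=
  ¬ IsPreconnected ({c}ᶜ : Set M)

/-- `c` is between `a` and `b` relative to the family `C` of cut points:
`c ∈ C` and the complement of `c` is a disjoint union of open sets separating
`a` from `b`. -/
def mBtw (C : Set M) (a c b : M) : Prop :=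
  c ∈ C ∧ ∃ U V : Set M, IsOpen U ∧ IsOpen V ∧ U ∩ V = ∅ ∧
    U ∪ V = ({c}ᶜ : Set M) ∧ a ∈ U ∧ b ∈ V

/-- The equivalence relation on `M` dual to `C`: each `c ∈ C` is equivalent only
to itself, and points of `M \ C` are equivalent iff no point separates them. -/
def cpRel (C : Set M) (a b : M) : Prop :=
  a = b ∨ (a ∉ C ∧ b ∉ C ∧ ¬ ∃ c : M, mBtw C a c b)

/-- The equivalence class of a point. -/
def CPClass (C : Set M) (a : M) : Set M := {b | cpRel C a b}

/-- The underlying set of the cut point pretree of `M` dual to `C`: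
the set of equivalence classes. -/
def CutPretree (M : Type u) [TopologicalSpace M] (C : Set M) : Type u :=
  {A : Set M // ∃ a : M, A = CPClass C a}

/-- Betweenness for (underlying sets of) classes: `z` is between `x` and `y`. -/
def kBtwSet (C : Set M) (x z y : Set M) : Prop :=
  (∃ c ∈ C, z = {c} ∧ ∀ a ∈ x, ∀ b ∈ y, mBtw C a c b) ∨
  ((∀ c ∈ z, c ∉ C) ∧ ∀ a ∈ x, ∀ b ∈ y, ∀ c ∈ z,
      insert a {t : M | mBtw C a t c} ∩ insert b {t : M | mBtw C c t b} = (∅ : Set M))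

/-- The betweenness relation of the cut point pretree of `M` dual to `C`. -/
def kBtw (M : Type u) [TopologicalSpace M] (C : Set M) :
    CutPretree M C → CutPretree M C → CutPretree M C → Prop :=
  fun x z y => kBtwSet C x.1 z.1 y.1

/-- The relation `≈` defining the dendrite quotient `D(M,C)`: `x ≈ y` iff the
set of points of `C` between `x` and `y` contains no subset order-isomorphic
to `ℚ`. -/
def dRel (C : Set M) (x y : M) : Prop :=
  ¬ ∃ f : ℚ → M, (∀ q : ℚ, f q ∈ C ∧ mBtw C x (f q) y) ∧
    ∀ q q' : ℚ, q < q' → mBtw C x (f q) (f q')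

/-! ### Dynamics -/

/-- The set of ordered distinct triples. -/
def DistinctTriples (M : Type u) : Set (M × M × M) :=
  {p | p.1 ≠ p.2.1 ∧ p.1 ≠ p.2.2 ∧ p.2.1 ≠ p.2.2}

/-- The diagonal action of a map on triples. -/
def tripleMap (f : M → M) : M × M × M → M × M × M :=
  fun p => (f p.1, f p.2.1, f p.2.2)

variable {Γ : Type w} [Group Γ]

/-- A convergence group action: `M` has at least three points, each element
acts as a homeomorphism (continuously), and the induced action on the space of
distinct triples is properly discontinuous. -/
def IsConvergenceAction {M : Type u} [TopologicalSpace M] (act : Γ → M → M) : Prop :=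
  (∃ a b c : M, a ≠ b ∧ a ≠ c ∧ b ≠ c) ∧
  (∀ g : Γ, Continuous (act g)) ∧
  (∀ L : Set (M × M × M), L ⊆ DistinctTriples M → IsCompact L →
    {g : Γ | (tripleMap (act g) '' L ∩ L).Nonempty}.Finite)

/-- A minimal action: no proper nonempty closed invariant subset. -/
def IsMinimalAction {M : Type u} [TopologicalSpace M] (act : Γ → M → M) : Prop :=
  ∀ A : Set M, IsClosed A → A.Nonempty → (∀ g : Γ, act g '' A ⊆ A) → A = Set.univ

/-- A parabolic point: fixed by some infinite subgroup that fixes no other point. -/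
def IsParabolicPoint {M : Type u} (act : Γ → M → M) (p : M) : Prop :=
  ∃ H : Subgroup Γ, (H : Set Γ).Infinite ∧ (∀ h ∈ H, act h p = p) ∧
    ∀ q : M, (∀ h ∈ H, act h q = q) → q = p

/-- An elementary subset of a convergence group: finite, or preserving setwise
a nonempty subset of `M` with at most two points. -/
def IsElementarySubset {M : Type u} (act : Γ → M → M) (S : Set Γ) : Prop :=
  S.Finite ∨ ∃ A : Set M, A.Nonempty ∧ (∃ a b : M, A ⊆ {a, b}) ∧ ∀ g ∈ S, act g '' A = A

/-- `Γ` splits relative to `PP` over torsion subgroups: `Γ` acts by graph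
automorphisms on a simplicial tree, without inversions, with no global fixed
vertex, with torsion edge stabilizers, and with each member of `PP` fixing a
vertex. -/
def SplitsOverTorsionRel (Γ : Type w) [Group Γ] (PP : Set (Subgroup Γ)) : Prop :=
  ∃ (V : Type w) (T : SimpleGraph V) (act : Γ →* Equiv.Perm V),
    T.IsTree ∧
    (∀ (g : Γ) (u v : V), T.Adj u v → T.Adj (act g u) (act g v)) ∧
    (∀ (g : Γ) (u v : V), T.Adj u v → ¬ (act g u = v ∧ act g v = u)) ∧
    (¬ ∃ v : V, ∀ g : Γ, act g v = v) ∧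
    (∀ u v : V, T.Adj u v → ∀ g : Γ, act g u = u → act g v = v → IsOfFinOrder g) ∧
    (∀ P ∈ PP, ∃ v : V, ∀ g ∈ P, act g v = v)

/-- A null family: for each open cover, all but finitely many members of the
family are contained in a single member of the cover. -/
def NullFamily (X : Type u) [TopologicalSpace X] (𝒞 : Set (Set X)) : Prop :=
  ∀ 𝒰 : Set (Set X), (∀ U ∈ 𝒰, IsOpen U) → ⋃₀ 𝒰 = Set.univ →
    {A ∈ 𝒞 | ¬ ∃ U ∈ 𝒰, A ⊆ U}.Finite

end RelHypBoundary

open RelHypBoundary Set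

namespace RelHypBoundary

section Intervals

variable {K : Type*} {btw : K → K → K → Prop}

theorem mem_closedInt {x y z : K} : y ∈ closedInt btw x z ↔ btw x y z ∨ y = x ∨ y = z :=
  Iff.rfl

theorem right_mem_closedInt (x z : K) : z ∈ closedInt btw x z :=
  mem_closedInt.2 (Or.inr (Or.inr rfl))

/-- Points of `[x,y]` are linearly ordered by their position seen from `x`. -/
theorem IsPretree.mem_closedInt_or (h : IsPretree btw) {x y a b : K}
    (ha : a ∈ closedInt btw x y) (hb : b ∈ closedInt btw x y) :
    a ∈ closedInt btw x b ∨ b ∈ closedInt btw x a := by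
  rw [mem_closedInt] at *
  rw [mem_closedInt]
  by_cases hab : a = b
  · exact Or.inl (Or.inr (Or.inr hab))
  rcases ha with ha | rfl | rfl
  · rcases hb with hb | rfl | rfl
    · rcases h.split b ha hab with h1 | h1
      · exact Or.inl (Or.inl h1)
      · rcases h.split a hb (Ne.symm hab) with h2 | h2
        · exact Or.inr (Or.inl h2)
        · exact absurd (h.symm h2) (h.asymm (h.symm h1))
    · exact Or.inr (Or.inr (Or.inl rfl))
    · exact Or.inl (Or.inl ha)
  · exact Or.inl (Or.inr (Or.inl rfl))
  · exact Or.inr hb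

theorem IsPretree.closedInt_subset (h : IsPretree btw) {x a b : K}
    (ha : a ∈ closedInt btw x b) : closedInt btw x a ⊆ closedInt btw x b := by
  intro z hz
  rw [mem_closedInt] at *
  rcases hz with hz | rfl | rfl
  · rcases ha with ha | rfl | rfl
    · have hza : a ≠ z := by
        rintro rfl
        exact h.asymm hz hz
      rcases h.split b hz (by rintro rfl; exact h.asymm ha hz) with h1 | h1
      · exact Or.inl h1
      · rcases h.split z ha hza with h2 | h2
        · exact absurd h2 (h.asymm hz)
        · exact absurd h1 (h.asymm (h.symm h2))
    · exact absurd rfl (h.ne_of_btw hz)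
    · exact Or.inl hz
  · exact Or.inr (Or.inl rfl)
  · exact ha

theorem IsPretree.eq_of_mem_closedInt (h : IsPretree btw) {x a b : K}
    (ha : a ∈ closedInt btw x b) (hb : b ∈ closedInt btw x a) : a = b := by
  rw [mem_closedInt] at *
  rcases ha with ha | rfl | rfl
  · rcases hb with hb | rfl | rfl
    · exact absurd ha (h.asymm hb)
    · exact absurd rfl (h.ne_of_btw ha)
    · rfl
  · rcases hb with hb | rfl | rfl
    · exact absurd rfl (h.ne_of_btw hb)
    · rfl
    · rfl
  · rfl

theorem PreservesBtw.image_closedInt {f : K → K} (hf : Function.Bijective f)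
    (hp : PreservesBtw btw f) (x z : K) :
    f '' closedInt btw x z = closedInt btw (f x) (f z) := by
  ext w
  obtain ⟨y, rfl⟩ := hf.2 w
  rw [hf.1.mem_set_image, mem_closedInt, mem_closedInt, ← hp, hf.1.eq_iff, hf.1.eq_iff]

end Intervals

section Actions

variable {K : Type*} {P : Type*} [Group P] {btw : K → K → K → Prop} {act : P → K → K}

/-- In a non-nesting action, if `g` fixes `x` and both `c` and `g c` lie in a common
interval `[x,y]`, then `g` fixes `c`. -/
theorem NonNesting.act_eq_self (hNN : NonNesting btw act) (hPre : IsPretree btw)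
    (hact_one : ∀ x : K, act 1 x = x)
    (hact_mul : ∀ (g h : P) (x : K), act (g * h) x = act g (act h x))
    (hauto : ∀ g : P, Function.Bijective (act g) ∧ PreservesBtw btw (act g))
    {x y c : K} {g : P} (hx : ∀ k : P, act k x = x)
    (hc : c ∈ closedInt btw x y) (hgc : act g c ∈ closedInt btw x y) : act g c = c := by
  have himage (k : P) (z : K) : act k '' closedInt btw x z = closedInt btw x (act k z) := by
    rw [PreservesBtw.image_closedInt (hauto k).1 (hauto k).2, hx]
  have hfix (k : P) (hk : act k c ∈ closedInt btw x c) : act k c = c := by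
    have hsub := hPre.closedInt_subset hk
    rw [← himage] at hsub
    have heq := hsub.eq_of_not_ssubset (hNN k x c)
    rw [himage] at heq
    exact hPre.eq_of_mem_closedInt hk (heq ▸ right_mem_closedInt x c)
  rcases hPre.mem_closedInt_or hgc hc with h | h
  · exact hfix g h
  · have hinv : act g⁻¹ (act g c) = c := by rw [← hact_mul, inv_mul_cancel, hact_one]
    have h' := mem_image_of_mem (act g⁻¹) h
    rw [himage, hinv] at h'
    have h1 := congrArg (act g) (hfix g⁻¹ h')
    rwa [← hact_mul, mul_inv_cancel, hact_one, eq_comm] at h1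

end Actions

end RelHypBoundary

/-- Let `P` be a finitely generated group with a non-nesting
action by pretree automorphisms on an interval complete median pretree `K`.
If `P` fixes a point of `K` and `K'` is any nonempty `P`-invariant full
subpretree of `K`, then `P` fixes a point of `K'`. -/
theorem fixed_point_in_invariant_subpretree {K : Type*} {P : Type*} [Group P]
    [Group.FG P]
    (btw : K → K → K → Prop) (hPre : IsPretree btw)
    (hIC : IsIntervalComplete btw) (hMed : IsMedianPretree btw)
    (act : P → K → K)
    (hact_one : ∀ x : K, act 1 x = x)
    (hact_mul : ∀ (g h : P) (x : K), act (g * h) x = act g (act h x))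
    (hauto : ∀ g : P, Function.Bijective (act g) ∧ PreservesBtw btw (act g))
    (hNN : NonNesting btw act)
    (hfix : ∃ x : K, ∀ g : P, act g x = x)
    (K' : Set K) (hne : K'.Nonempty) (hfullK' : IsFull btw K')
    (hinv : ∀ g : P, act g '' K' = K') :
    ∃ x ∈ K', ∀ g : P, act g x = x := by
  obtain ⟨x, hx⟩ := hfix
  have hself {y c : K} {g : P} (hc : c ∈ closedInt btw x y)
      (hgc : act g c ∈ closedInt btw x y) : act g c = c :=
    hNN.act_eq_self hPre hact_one hact_mul hauto hx hc hgc
  have himage (g : P) (z : K) : act g '' closedInt btw x z = closedInt btw x (act g z) := by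
    rw [PreservesBtw.image_closedInt (hauto g).1 (hauto g).2, hx]
  have hfin (S : Finset P) : ∃ m ∈ K', ∀ g ∈ S, act g m = m := by
    classical
    induction S using Finset.induction_on with
    | empty => exact ⟨hne.some, hne.some_mem, by simp⟩
    | insert g S _ ih =>
      obtain ⟨y, hy, hS⟩ := ih
      obtain ⟨m, hm1, hm2, hm3⟩ := hMed x y (act g y)
      have hgy : act g y ∈ K' := hinv g ▸ mem_image_of_mem (act g) hy
      refine ⟨m, hfullK' y hy _ hgy hm2, ?_⟩
      intro k hk
      rcases Finset.mem_insert.1 hk with rfl | hk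
      · have hm : m ∈ closedInt btw x (act k y) := by
          rw [mem_closedInt] at hm3 ⊢
          exact hm3.imp hPre.symm Or.symm
        rw [← himage] at hm
        obtain ⟨c, hc, rfl⟩ := hm
        exact congrArg (act k) (hself hc hm1)
      · have hkm := mem_image_of_mem (act k) hm1
        rw [himage, hS k hk] at hkm
        exact hself hm1 hkm
  obtain ⟨S, hS⟩ := Group.fg_def.1 ‹Group.FG P›
  obtain ⟨m, hm, hSm⟩ := hfin S
  refine ⟨m, hm, fun g => ?_⟩
  have hg : g ∈ Subgroup.closure (S : Set P) := hS ▸ Subgroup.mem_top g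
  induction hg using Subgroup.closure_induction with
  | mem k hk => exact hSm k hk
  | one => exact hact_one m
  | mul a b _ _ ha hb => rw [hact_mul, hb, ha]
  | inv a _ ha =>
    have h := congrArg (act a⁻¹) ha
    rwa [← hact_mul, inv_mul_cancel, hact_one, eq_comm] at h
end

section
/- Let K be a complete median pretree, and let X and Y be nonempty, disjoint, full subsets of K such that X ∪ Y is full. If the connector point p(Y,X) exists, it is unique; furthermore, at least one of the ordered pairs (X,Y) and (Y,X) has a connector point. -/
open Set

universe u v w

open RelHypBoundary Set

namespace RelHypBoundary

variable {K : Type*} {btw : K → K → K → Prop}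

theorem closedInt_comm (h : IsPretree btw) (x z : K) :
    closedInt btw x z = closedInt btw z x := by
  ext y
  have h₁ := @h.symm x y z
  have h₂ := @h.symm z y x
  simp only [mem_closedInt]
  tauto

theorem openInt_comm (h : IsPretree btw) (x z : K) : openInt btw x z = openInt btw z x :=
  Set.ext fun _ => ⟨h.symm, h.symm⟩

namespace IsPretree

theorem ne_right (h : IsPretree btw) {x y z : K} (hb : btw x y z) : y ≠ z := by
  rintro rfl
  exact h.asymm hb hb

theorem ne_left (h : IsPretree btw) {x y z : K} (hb : btw x y z) : y ≠ x :=
  h.ne_right (h.symm hb)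

theorem not_btw_left (h : IsPretree btw) {x y z : K} (hb : btw x y z) : ¬ btw y x z :=
  fun hc => h.asymm (h.symm hb) (h.symm hc)

theorem trans_left (h : IsPretree btw) {x y z w : K} (hz : btw x z y) (hw : btw x w z) :
    btw x w y := by
  have hwy : w ≠ y := by
    rintro rfl
    exact h.asymm hz hw
  rcases h.split y hw hwy with h₁ | h₁
  · exact h₁
  · rcases h.split w hz (h.ne_right hw).symm with h₂ | h₂
    · exact absurd h₂ (h.asymm hw)
    · exact absurd h₁ (h.asymm (h.symm h₂))

theorem isFull_closedInt (h : IsPretree btw) (x y : K) : IsFull btw (closedInt btw x y) := by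
  have from_left : ∀ {a b v w : K}, v ∈ closedInt btw a b → btw a w v → btw a w b := by
    rintro a b v w (hv | rfl | rfl) hw
    · exact h.trans_left hv hw
    · exact absurd rfl (h.ne_of_btw hw)
    · exact hw
  intro u hu v hv w hw
  rcases hw with hw | rfl | rfl
  · by_cases hwx : w = x
    · exact Or.inr (Or.inl hwx)
    · rcases h.split x hw hwx with h₁ | h₁
      · exact Or.inl (from_left hu (h.symm h₁))
      · exact Or.inl (from_left hv h₁)
  · exact hu
  · exact hv

theorem btw_or_btw (h : IsPretree btw) {x y u v : K} (hu : btw x u y) (hv : btw x v y)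
    (huv : u ≠ v) : btw x u v ∨ btw x v u := by
  rcases h.split v hu huv with h₁ | h₁
  · exact Or.inl h₁
  · rcases h.split u hv huv.symm with h₂ | h₂
    · exact Or.inr h₂
    · exact absurd h₂ (h.not_btw_left h₁)

theorem btw_of_btw_of_btw (h : IsPretree btw) {x u v w : K} (hv : btw x u v) (hw : btw x v w) :
    btw u v w := by
  rcases h.split u hw (h.ne_right hv).symm with h₁ | h₁
  · exact absurd h₁ (h.asymm hv)
  · exact h₁

theorem not_btw_of_mem_closedInt (h : IsPretree btw) {x y u v : K}
    (hu : u ∈ closedInt btw x y) (hv : v ∈ closedInt btw x y) : ¬ btw u x v := by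
  intro hb
  have hux := h.ne_left hb
  have hvx := h.ne_right hb
  have huv := h.ne_of_btw hb
  rcases hu with hu | rfl | rfl
  · rcases hv with hv | rfl | rfl
    · rcases h.split y hb (h.ne_of_btw hu) with h₁ | h₁
      · exact h.not_btw_left hu h₁
      · exact h.not_btw_left hv (h.symm h₁)
    · exact hvx rfl
    · exact h.not_btw_left hu hb
  · exact hux rfl
  · rcases hv with hv | rfl | rfl
    · exact h.not_btw_left hv (h.symm hb)
    · exact hvx rfl
    · exact huv rfl

theorem closedInt_linear (h : IsPretree btw) {x y u v w : K} (hu : u ∈ closedInt btw x y)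
    (hv : v ∈ closedInt btw x y) (hw : w ∈ closedInt btw x y)
    (huv : u ≠ v) (hvw : v ≠ w) (huw : u ≠ w) :
    btw u v w ∨ btw v w u ∨ btw w u v := by
  have total : ∀ {a b : K}, a ∈ closedInt btw x y → b ∈ closedInt btw x y → a ≠ x → b ≠ x →
      a ≠ b → btw x a b ∨ btw x b a := by
    rintro a b (ha | rfl | rfl) (hb | rfl | rfl) hax hbx hab
    all_goals first
      | exact h.btw_or_btw ‹_› ‹_› hab
      | exact absurd rfl ‹_›
      | exact Or.inl ‹_›
      | exact Or.inr ‹_›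
  by_cases hux : u = x
  · subst hux
    rcases total hv hw huv.symm huw.symm hvw with h₁ | h₁
    · exact Or.inl h₁
    · exact Or.inr (Or.inl (h.symm h₁))
  by_cases hvx : v = x
  · subst hvx
    rcases total hu hw hux hvw.symm huw with h₁ | h₁
    · exact Or.inr (Or.inr (h.symm h₁))
    · exact Or.inr (Or.inl h₁)
  by_cases hwx : w = x
  · subst hwx
    rcases total hu hv hux hvx huv with h₁ | h₁
    · exact Or.inr (Or.inr h₁)
    · exact Or.inl (h.symm h₁)
  rcases total hu hv hux hvx huv with h₁ | h₁ <;> rcases total hv hw hvx hwx hvw with h₂ | h₂ <;>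
    rcases total hu hw hux hwx huw with h₃ | h₃
  · exact Or.inl (h.btw_of_btw_of_btw h₁ h₂)
  · exact Or.inl (h.btw_of_btw_of_btw h₁ h₂)
  · exact Or.inr (Or.inl (h.symm (h.btw_of_btw_of_btw h₃ h₂)))
  · exact Or.inr (Or.inr (h.btw_of_btw_of_btw h₃ h₁))
  · exact Or.inr (Or.inr (h.symm (h.btw_of_btw_of_btw h₁ h₃)))
  · exact Or.inr (Or.inl (h.btw_of_btw_of_btw h₂ h₃))
  · exact Or.inl (h.symm (h.btw_of_btw_of_btw h₂ h₁))
  · exact Or.inl (h.symm (h.btw_of_btw_of_btw h₂ h₁))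

theorem isArc_closedInt_inter (h : IsPretree btw) {X : Set K} (hX : IsFull btw X) {x : K}
    (hx : x ∈ X) (y : K) : IsArc btw (closedInt btw x y ∩ X) :=
  ⟨⟨x, Or.inr (Or.inl rfl), hx⟩,
    fun u hu v hv => subset_inter (h.isFull_closedInt x y u hu.1 v hv.1) (hX u hu.2 v hv.2),
    fun _ hu _ hv _ hw => h.closedInt_linear hu.1 hv.1 hw.1⟩

end IsPretree

theorem IsIntervalSet.openInt_subset_subset_closedInt {A : Set K} (hA : IsIntervalSet btw A) :
    ∃ a b : K, openInt btw a b ⊆ A ∧ A ⊆ closedInt btw a b := by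
  obtain ⟨a, b, rfl | rfl | rfl | rfl⟩ := hA
  · exact ⟨a, b, Subset.rfl, subset_union_left⟩
  · exact ⟨a, b, subset_union_left, Subset.rfl⟩
  · exact ⟨a, b, subset_insert _ _,
      insert_subset (Or.inr (Or.inl rfl)) subset_union_left⟩
  · exact ⟨a, b, subset_insert _ _,
      insert_subset (Or.inr (Or.inr rfl)) subset_union_left⟩

/-- An interval with an extremal point `x` runs from `x` to some other point `b`. -/
theorem exists_openInt_subset_subset_closedInt (h : IsPretree btw) {A : Set K}
    (hA : IsIntervalSet btw A) {x : K} (hx : x ∈ A)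
    (hext : ∀ u ∈ A, ∀ v ∈ A, ¬ btw u x v) :
    ∃ b : K, openInt btw x b ⊆ A ∧ A ⊆ closedInt btw x b := by
  obtain ⟨a, b, hab, hAab⟩ := hA.openInt_subset_subset_closedInt
  rcases hAab hx with hxab | rfl | rfl
  · have side : ∀ u ∈ A, u ∈ closedInt btw x a ∨ u ∈ closedInt btw x b := by
      intro u hu
      by_cases hux : u = x
      · exact Or.inl (Or.inr (Or.inl hux))
      rcases hAab hu with hu | rfl | rfl
      · rcases h.split x hu hux with h₁ | h₁
        · exact Or.inl (Or.inl (h.symm h₁))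
        · exact Or.inr (Or.inl h₁)
      · exact Or.inl (Or.inr (Or.inr rfl))
      · exact Or.inr (Or.inr (Or.inr rfl))
    have cross : ∀ u ∈ closedInt btw x a, ∀ v ∈ closedInt btw x b, u ≠ x → v ≠ x →
        btw u x v := by
      intro u hu v hv hux hvx
      have h₁ : btw u x b := by
        rcases hu with hu | rfl | rfl
        · rcases h.split u hxab hux.symm with h₁ | h₁
          · exact absurd (h.symm h₁) (h.not_btw_left hu)
          · exact h₁
        · exact absurd rfl hux
        · exact hxab
      rcases hv with hv | rfl | rfl
      · rcases h.split v h₁ hvx.symm with h₂ | h₂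
        · exact h₂
        · exact absurd h₂ (h.not_btw_left hv)
      · exact absurd rfl hvx
      · exact h₁
    by_cases hall : A ⊆ closedInt btw x b
    · exact ⟨b, fun z hz => hab (h.symm (h.trans_left (h.symm hxab) (h.symm hz))), hall⟩
    · obtain ⟨u, hu, hub⟩ := not_subset.1 hall
      refine ⟨a, fun z hz => hab (h.trans_left hxab (h.symm hz)), fun v hv => ?_⟩
      rcases side v hv with hva | hvb
      · exact hva
      · by_cases hvx : v = x
        · exact Or.inr (Or.inl hvx)
        · have hux : u ≠ x := fun e => hub (Or.inr (Or.inl e))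
          exact absurd (cross u ((side u hu).resolve_right hub) v hvb hux hvx) (hext u hu v hv)
  · exact ⟨b, hab, hAab⟩
  · exact ⟨a, openInt_comm h a x ▸ hab, closedInt_comm h a x ▸ hAab⟩

theorem IsConnector.eq (h : IsMedianPretree btw) (hPre : IsPretree btw) {X Y : Set K}
    (hX : X.Nonempty) (hY : IsFull btw Y) {p q : K} (hp : IsConnector btw Y X p)
    (hq : IsConnector btw Y X q) : p = q := by
  obtain ⟨x, hx⟩ := hX
  obtain ⟨m, hxp, hpq, hqx⟩ := h x p q
  have hmY : m ∈ Y := hY p hp.1 q hq.1 hpq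
  have h₁ : m ∈ ({p} : Set K) := hp.2 x hx ▸ ⟨hxp, hmY⟩
  have h₂ : m ∈ ({q} : Set K) := hq.2 x hx ▸ ⟨closedInt_comm hPre q x ▸ hqx, hmY⟩
  exact (mem_singleton_iff.1 h₁).symm.trans (mem_singleton_iff.1 h₂)

/-- A point of `X` that is last in `X` on the way to one point of `Y` is a connector point. -/
theorem isConnector_of_forall_mem_closedInt (h : IsPretree btw) (hMed : IsMedianPretree btw)
    {X Y : Set K} (hdisj : X ∩ Y = ∅) (hY : IsFull btw Y) {p y : K} (hp : p ∈ X) (hy : y ∈ Y)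
    (hlast : ∀ z ∈ closedInt btw p y, z ∈ X → z = p) : IsConnector btw X Y p := by
  have hXY : ∀ z ∈ X, z ∉ Y := fun z hz hz' => hdisj.subset ⟨hz, hz'⟩
  refine ⟨hp, fun y' hy' => Subset.antisymm ?_ ?_⟩
  · rintro z ⟨hz | rfl | rfl, hzX⟩
    · obtain ⟨m, hpy, hyy', hy'p⟩ := hMed p y y'
      have hmY : m ∈ Y := hY y hy y' hy' hyy'
      have hzm : z ≠ m := fun e => hXY z hzX (e ▸ hmY)
      rcases h.split m hz hzm with h₁ | h₁
      · exact absurd (hY y' hy' m hmY (Or.inl h₁)) (hXY z hzX)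
      · refine hlast z ?_ hzX
        exact h.isFull_closedInt p y m hpy p (Or.inr (Or.inl rfl)) (Or.inl h₁)
    · exact absurd hy' (hXY z hzX)
    · rfl
  · rintro z rfl
    exact ⟨Or.inr (Or.inr rfl), hp⟩

theorem exists_isConnector (hPre : IsPretree btw) (hComp : IsCompletePretree btw)
    (hMed : IsMedianPretree btw) {X Y : Set K} (hXne : X.Nonempty) (hYne : Y.Nonempty)
    (hdisj : X ∩ Y = ∅) (hX : IsFull btw X) (hY : IsFull btw Y) (hXY : IsFull btw (X ∪ Y)) :
    (∃ p : K, IsConnector btw Y X p) ∨ ∃ p : K, IsConnector btw X Y p := by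
  obtain ⟨x, hx⟩ := hXne
  obtain ⟨y, hy⟩ := hYne
  have hne : ∀ z ∈ X, z ∉ Y := fun z hz hz' => hdisj.subset ⟨hz, hz'⟩
  by_cases hlast : ∃ p ∈ X, ∀ z ∈ closedInt btw p y, z ∈ X → z = p
  · obtain ⟨p, hp, hlast⟩ := hlast
    exact Or.inr ⟨p, isConnector_of_forall_mem_closedInt hPre hMed hdisj hY hp hy hlast⟩
  push Not at hlast
  left
  obtain ⟨b, hbA, hAb⟩ := exists_openInt_subset_subset_closedInt hPre
    (hComp _ (hPre.isArc_closedInt_inter hX hx y)) ⟨Or.inr (Or.inl rfl), hx⟩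
    fun u hu v hv => hPre.not_btw_of_mem_closedInt hu.1 hv.1
  have next : ∀ p ∈ closedInt btw x y ∩ X, ∃ q ∈ closedInt btw x y ∩ X, btw p q y ∧
      (p = x ∨ btw x p q) := by
    rintro p ⟨hp, hpX⟩
    obtain ⟨q, hq, hqX, hqp⟩ := hlast p hpX
    have hpqy : btw p q y := by
      rcases hq with hq | rfl | rfl
      · exact hq
      · exact absurd rfl hqp
      · exact absurd hy (hne q hqX)
    refine ⟨q, ⟨hPre.isFull_closedInt x y p hp y (Or.inr (Or.inr rfl)) hq, hqX⟩, hpqy, ?_⟩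
    rcases hp with hp | rfl | rfl
    · rcases hPre.split q hp hqp.symm with h₁ | h₁
      · exact Or.inr h₁
      · exact absurd h₁ (hPre.not_btw_left hpqy)
    · exact Or.inl rfl
    · exact absurd hy (hne p hpX)
  have hbX : b ∉ closedInt btw x y ∩ X := by
    intro hb
    obtain ⟨q, hq, hbqy, hxbq⟩ := next b hb
    have hqb := hPre.ne_left hbqy
    rcases hAb hq with h₁ | rfl | rfl
    · rcases hxbq with rfl | h₂
      · exact hPre.ne_of_btw h₁ rfl
      · exact hPre.asymm h₁ h₂
    · rcases hxbq with rfl | h₂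
      · exact hqb rfl
      · exact hPre.ne_of_btw h₂ rfl
    · exact hqb rfl
  obtain ⟨m, hxb, hby, hyx⟩ := hMed x b y
  rw [closedInt_comm hPre] at hyx
  have hmb : m = b := by
    by_contra hmb
    have hm : m ∈ closedInt btw x y ∩ X := by
      rcases hxb with h₁ | rfl | rfl
      · exact hbA h₁
      · exact ⟨Or.inr (Or.inl rfl), hx⟩
      · exact absurd rfl hmb
    obtain ⟨q, hq, hmqy, hxmq⟩ := next m hm
    have hxqb : btw x q b := by
      rcases hAb hq with h₁ | rfl | rfl
      · exact h₁
      · rcases hxmq with rfl | h₂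
        · exact absurd rfl (hPre.ne_left hmqy)
        · exact absurd rfl (hPre.ne_of_btw h₂)
      · exact absurd hq hbX
    have hmqb : btw m q b := by
      rcases hxmq with rfl | h₂
      · exact hxqb
      · exact hPre.btw_of_btw_of_btw h₂ hxqb
    rcases hby with h₁ | h₁ | rfl
    · rcases hPre.split q h₁ (hPre.ne_left hmqy).symm with h₂ | h₂
      · exact hPre.asymm h₂ (hPre.symm hmqb)
      · exact hPre.not_btw_left hmqy h₂
    · exact hmb h₁
    · exact hPre.ne_of_btw hmqy rfl
  subst hmb
  have hmY : m ∈ Y := (hXY x (Or.inl hx) y (Or.inr hy) hyx).resolve_left fun h => hbX ⟨hyx, h⟩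
  refine ⟨m, isConnector_of_forall_mem_closedInt hPre hMed (inter_comm X Y ▸ hdisj) hX hmY hx ?_⟩
  rintro z (hz | rfl | rfl) hzY
  · exact absurd hzY (hne z (hbA (hPre.symm hz)).2)
  · rfl
  · exact absurd hzY (hne z hx)

end RelHypBoundary

/-- In a complete median pretree, for nonempty, disjoint, full
subsets `X`, `Y` with `X ∪ Y` full: the connector point `p(Y,X)`, if it exists,
is unique, and at least one of the ordered pairs `(X,Y)`, `(Y,X)` has a
connector point. -/
theorem connector_exists_unique {K : Type*}
    (btw : K → K → K → Prop) (hPre : IsPretree btw)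
    (hComp : IsCompletePretree btw) (hMed : IsMedianPretree btw)
    (X Y : Set K) (hXne : X.Nonempty) (hYne : Y.Nonempty)
    (hdisj : X ∩ Y = ∅) (hXfull : IsFull btw X) (hYfull : IsFull btw Y)
    (hXYfull : IsFull btw (X ∪ Y)) :
    (∀ p p' : K, IsConnector btw Y X p → IsConnector btw Y X p' → p = p') ∧
    ((∃ p : K, IsConnector btw Y X p) ∨ (∃ p : K, IsConnector btw X Y p)) := by
  exact ⟨fun _ _ hp hq => hp.eq hMed hPre hXne hYfull hq,
    exists_isConnector hPre hComp hMed hXne hYne hdisj hXfull hYfull hXYfull⟩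
end
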